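/- Let d ≥ 1, let S, T ⊆ ℝ^d, let f : ℝ^d × ℝ^d → ℝ, and let w ∈ ℝ. Suppose h ∈ ℕ is a Helly bound (in ℝ^(2d)) for the set {(x, y) ∈ S × T : f(x,y) ≥ w}. Let F be a finite family of convex sets in ℝ^d. If the intersection of every subfamily of F with at most h members contains an axis-parallel box bx(x,y) with (x,y) ∈ S × T and f(x,y) ≥ w, then the intersection of all members of F contains an axis-parallel box bx(a,b) with (a,b) ∈ S × T and f(a,b) ≥ w. -/

import Mathlib

/-- `h` is a Helly bound for a subset `S` of a real vector space `E` (for us, `E` will be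
`ℝ^d × ℝ^d ≅ ℝ^(2d)`): for every finite family `F` of convex sets in `E`, if the
intersection of every subfamily of at most `h` members of `F` contains a point of `S`,
then the intersection of all members of `F` contains a point of `S`. -/
def HellyBound {E : Type*} [AddCommGroup E] [Module ℝ E] (S : Set E) (h : ℕ) : Prop :=
  ∀ F : Finset (Set E), (∀ A ∈ F, Convex ℝ A) →
    (∀ G ⊆ F, G.card ≤ h → ∃ p ∈ S, ∀ A ∈ G, p ∈ A) →
    ∃ p ∈ S, ∀ A ∈ F, p ∈ A

/-- The pairs `(x, y)` of corners of nonempty boxes contained in `A`. -/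
def boxCorners {ι : Type*} (A : Set (ι → ℝ)) : Set ((ι → ℝ) × (ι → ℝ)) :=
  {q | q.1 ≤ q.2 ∧ Set.Icc q.1 q.2 ⊆ A}

/-- A point of a convex combination of two nonempty boxes is the same convex combination of
points of the two boxes. -/
theorem exists_smul_add_smul_of_mem_Icc {ι : Type*} {x y x' y' z : ι → ℝ} {a b : ℝ}
    (hxy : x ≤ y) (hxy' : x' ≤ y')
    (hz : z ∈ Set.Icc (a • x + b • x') (a • y + b • y')) :
    ∃ u ∈ Set.Icc x y, ∃ v ∈ Set.Icc x' y', a • u + b • v = z := by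
  have key : ∀ i, ∃ u v, u ∈ Set.Icc (x i) (y i) ∧ v ∈ Set.Icc (x' i) (y' i) ∧
      a * u + b * v = z i := by
    intro i
    have hzi : z i ∈ Set.Icc (a * x i + b * x' i) (a * y i + b * y' i) := ⟨hz.1 i, hz.2 i⟩
    rw [← segment_eq_Icc (hzi.1.trans hzi.2)] at hzi
    obtain ⟨p, q, hp, hq, hpq, hzi⟩ := hzi
    refine ⟨p • x i + q • y i, p • x' i + q • y' i, ?_, ?_, ?_⟩
    · rw [← segment_eq_Icc (hxy i)]
      exact ⟨p, q, hp, hq, hpq, rfl⟩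
    · rw [← segment_eq_Icc (hxy' i)]
      exact ⟨p, q, hp, hq, hpq, rfl⟩
    · rw [← hzi]
      simp only [smul_eq_mul]
      ring
  choose u v hu hv huv using key
  exact ⟨u, ⟨fun i => (hu i).1, fun i => (hu i).2⟩, v, ⟨fun i => (hv i).1, fun i => (hv i).2⟩,
    funext huv⟩

theorem Convex.boxCorners {ι : Type*} {A : Set (ι → ℝ)} (hA : Convex ℝ A) :
    Convex ℝ (boxCorners A) := by
  rintro ⟨x, y⟩ ⟨hxy, hsub⟩ ⟨x', y'⟩ ⟨hxy', hsub'⟩ a b ha hb hab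
  refine ⟨add_le_add (smul_le_smul_of_nonneg_left hxy ha)
    (smul_le_smul_of_nonneg_left hxy' hb), fun z hz => ?_⟩
  obtain ⟨u, hu, v, hv, rfl⟩ := exists_smul_add_smul_of_mem_Icc hxy hxy' hz
  exact hA (hsub hu) (hsub' hv) ha hb hab

/-- Basic Helly-type theorem for weighted boxes: if `h` is a Helly bound (in
`ℝ^d × ℝ^d ≅ ℝ^(2d)`) for `{(x,y) ∈ S × T : f(x,y) ≥ w}`, and every subfamily of at most
`h` members of a finite family `F` of convex sets in `ℝ^d` has, in its intersection, a
box `bx(x,y)` parametrized in `S × T` with weight `f(x,y) ≥ w`, then so does the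
intersection of the whole family. -/
theorem basic_box_helly (d : ℕ) (hd : 1 ≤ d) (S T : Set (Fin d → ℝ))
    (f : (Fin d → ℝ) → (Fin d → ℝ) → ℝ) (w : ℝ) (h : ℕ)
    (hH : HellyBound {q : (Fin d → ℝ) × (Fin d → ℝ) | q.1 ∈ S ∧ q.2 ∈ T ∧ w ≤ f q.1 q.2} h)
    (F : Finset (Set (Fin d → ℝ))) (hconv : ∀ A ∈ F, Convex ℝ A)
    (hloc : ∀ G ⊆ F, G.card ≤ h →
      ∃ x y : Fin d → ℝ, x ≤ y ∧ x ∈ S ∧ y ∈ T ∧ w ≤ f x y ∧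
        ∀ A ∈ G, Set.Icc x y ⊆ A) :
    ∃ a b : Fin d → ℝ, a ≤ b ∧ a ∈ S ∧ b ∈ T ∧ w ≤ f a b ∧
      ∀ A ∈ F, Set.Icc a b ⊆ A := by
  classical
  obtain rfl | ⟨A₀, hA₀⟩ := F.eq_empty_or_nonempty
  · exact hloc ∅ subset_rfl (Nat.zero_le h)
  obtain ⟨⟨a, b⟩, ⟨haS, hbT, hw⟩, hmem⟩ := hH (F.image boxCorners)
    (by
      intro C hC
      obtain ⟨A, hA, rfl⟩ := Finset.mem_image.mp hC
      exact (hconv A hA).boxCorners)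
    (by
      intro G hG hcard
      obtain ⟨G', hG'F, hinj, rfl⟩ := Finset.exists_subset_injOn_image_eq_of_surjOn
        (f := boxCorners) (F : Set (Set (Fin d → ℝ))) G
        (fun C hC => by simpa using hG hC)
      rw [Finset.coe_subset] at hG'F
      rw [Finset.card_image_of_injOn hinj] at hcard
      obtain ⟨x, y, hxy, hx, hy, hw, hsub⟩ := hloc G' hG'F hcard
      refine ⟨(x, y), ⟨hx, hy, hw⟩, fun C hC => ?_⟩
      obtain ⟨A, hA, rfl⟩ := Finset.mem_image.mp hC
      exact ⟨hxy, hsub A hA⟩)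
  have hbox : ∀ A ∈ F, (a, b) ∈ boxCorners A := fun A hA =>
    hmem _ (Finset.mem_image_of_mem _ hA)
  exact ⟨a, b, (hbox A₀ hA₀).1, haS, hbT, hw, fun A hA => (hbox A hA).2⟩
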